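/- There exists an R-linear map μ : 𝔤 → A which is a Lie algebra homomorphism into the commutator Lie algebra of A (μ([ξ,η]) = μ(ξ)μ(η) − μ(η)μ(ξ)) and induces the given inner derivations ([μ(ξ), u] = [a_ξ, u] for all ξ ∈ 𝔤, u ∈ A) if and only if λ is a coboundary, i.e. there exists an R-linear map τ : 𝔤 → Z(A) with λ(ξ,η) = τ([ξ,η]) for all ξ, η ∈ 𝔤. (This is the algebraic criterion for the existence of a quantum momentum map: it exists iff the class [λ] vanishes.) -/

import Mathlib

/-- The 2-cochain `λ(ξ,η) = a_{[ξ,η]} − (a_ξ a_η − a_η a_ξ)`. -/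
def lamCocycle {R : Type*} [CommRing R] {A : Type*} [Ring A] [Algebra R A]
    {L : Type*} [LieRing L] [LieAlgebra R L] (a : L →ₗ[R] A) (ξ η : L) : A :=
  a ⁅ξ, η⁆ - (a ξ * a η - a η * a ξ)

/-- existence criterion for quantum momentum maps: there is an `R`-linear
Lie algebra homomorphism `μ : 𝔤 → A` into the commutator algebra inducing the given
inner derivations iff `λ` is a coboundary, i.e. `λ(ξ,η) = τ([ξ,η])` for some `R`-linear
central-valued `τ`. -/
theorem quantum_momentum_map_exists_iff
    (R : Type*) [CommRing R] (A : Type*) [Ring A] [Algebra R A]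
    (L : Type*) [LieRing L] [LieAlgebra R L] (a : L →ₗ[R] A)
    (hrep : ∀ (ξ η : L) (u : A),
      a ⁅ξ, η⁆ * u - u * a ⁅ξ, η⁆ =
        (a ξ * (a η * u - u * a η) - (a η * u - u * a η) * a ξ) -
          (a η * (a ξ * u - u * a ξ) - (a ξ * u - u * a ξ) * a η)) :
    (∃ μ : L →ₗ[R] A,
      (∀ ξ η : L, μ ⁅ξ, η⁆ = μ ξ * μ η - μ η * μ ξ) ∧
      (∀ (ξ : L) (u : A), μ ξ * u - u * μ ξ = a ξ * u - u * a ξ)) ↔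
    (∃ τ : L →ₗ[R] A,
      (∀ (ξ : L) (u : A), τ ξ * u = u * τ ξ) ∧
      (∀ ξ η : L, lamCocycle a ξ η = τ ⁅ξ, η⁆)) := by
  constructor
  · rintro ⟨μ, hμ, hind⟩
    refine ⟨a - μ, fun ξ u => ?_, fun ξ η => ?_⟩
    · have h := hind ξ u
      rw [LinearMap.sub_apply, sub_mul, mul_sub, sub_eq_sub_iff_add_eq_add]
      rw [sub_eq_sub_iff_add_eq_add] at h
      rw [← h.symm.trans (add_comm _ _)]
    · have h1 := hind ξ (μ η)
      have h2 := hind η (a ξ)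
      have h3 : μ ξ * μ η - μ η * μ ξ = a ξ * a η - a η * a ξ := by
        rw [h1, ← neg_sub, h2, neg_sub]
      rw [LinearMap.sub_apply, hμ, h3, lamCocycle]
  · rintro ⟨τ, hc, hτ⟩
    refine ⟨a - τ, fun ξ η => ?_, fun ξ u => ?_⟩
    · have h := hτ ξ η
      rw [lamCocycle] at h
      simp only [LinearMap.sub_apply, sub_mul, mul_sub]
      rw [← h, hc ξ (a η), hc η (a ξ), hc ξ (τ η)]
      abel
    · simp only [LinearMap.sub_apply, sub_mul, mul_sub]
      rw [hc ξ u]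
      abel
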